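/- Let ρ and ρ̄ be equally weighted Gaussian mixtures on ℝ^d, each with k identity-covariance components, with means μ_1,…,μ_k and μ̄_1,…,μ̄_k respectively. If the law of Δ = ‖X_1 − X_2‖² for X_1, X_2 independent samples from ρ equals the law of the corresponding quantity for ρ̄, then for every integer n ≥ 0, Σ_{1 ≤ i < j ≤ k} ‖μ_i − μ_j‖^{2n} = Σ_{1 ≤ i < j ≤ k} ‖μ̄_i − μ̄_j‖^{2n}. -/

import Mathlib

open MeasureTheory

/-- The Gaussian-mixture density on `ℝ^d` with identity covariances,
weights `w i` and means `μ i`. -/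
noncomputable def gaussMixture {d k : ℕ} (w : Fin k → ℝ)
    (μ : Fin k → EuclideanSpace ℝ (Fin d)) : EuclideanSpace ℝ (Fin d) → ℝ := fun x =>
  ∑ i, w i * ((2 * Real.pi) ^ (-(d : ℝ) / 2) * Real.exp (-‖x - μ i‖ ^ 2 / 2))

/-- The distribution of distances of a density `ρ` on `ℝ^d`: the law of
`Δ = ‖X₁ - X₂‖²` where `X₁, X₂` are independent with density `ρ`. -/
noncomputable def distDistrib {d : ℕ} (ρ : EuclideanSpace ℝ (Fin d) → ℝ) : Measure ℝ :=
  Measure.map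
    (fun p : EuclideanSpace ℝ (Fin d) × EuclideanSpace ℝ (Fin d) => ‖p.1 - p.2‖ ^ 2)
    ((volume.withDensity fun x => ENNReal.ofReal (ρ x)).prod
      (volume.withDensity fun x => ENNReal.ofReal (ρ x)))

theorem lintegral_gaussian_mul_gaussian {d : ℕ} (a b : EuclideanSpace ℝ (Fin d)) {t : ℝ}
    (ht : 0 ≤ t) :
    ∫⁻ y, ENNReal.ofReal (Real.exp (-‖y - b‖ ^ 2 / 2)) *
        ENNReal.ofReal (Real.exp (-t * ‖a - y‖ ^ 2)) =
      ENNReal.ofReal ((Real.pi / (1 / 2 + t)) ^ (d / 2 : ℝ)) *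
        ENNReal.ofReal (Real.exp (-(t / (1 + 2 * t)) * ‖a - b‖ ^ 2)) := by
  have hb : 0 < 1 / 2 + t := by linarith
  set p : EuclideanSpace ℝ (Fin d) := b + (2 * t / (1 + 2 * t)) • (a - b) with hp
  have hsq (y : EuclideanSpace ℝ (Fin d)) :
      ‖y - b‖ ^ 2 / 2 + t * ‖a - y‖ ^ 2 =
        (1 / 2 + t) * ‖y - p‖ ^ 2 + t / (1 + 2 * t) * ‖a - b‖ ^ 2 := by
    have h1 : a - y = (a - b) - (y - b) := by abel
    have h2 : y - p = (y - b) - (2 * t / (1 + 2 * t)) • (a - b) := by rw [hp]; abel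
    rw [h1, h2, norm_sub_sq_real (a - b), norm_sub_sq_real (y - b), norm_smul,
      real_inner_smul_right, real_inner_comm, mul_pow, Real.norm_eq_abs, sq_abs]
    have : 1 + 2 * t ≠ 0 := by linarith
    field_simp
    ring
  have hint : ∫ y : EuclideanSpace ℝ (Fin d), Real.exp (-(1 / 2 + t) * ‖y‖ ^ 2) =
      (Real.pi / (1 / 2 + t)) ^ (d / 2 : ℝ) := by
    simpa using GaussianFourier.integral_rexp_neg_mul_sq_norm (V := EuclideanSpace ℝ (Fin d)) hb
  have hpos : 0 < (Real.pi / (1 / 2 + t)) ^ (d / 2 : ℝ) := by positivity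
  have hintegrable : Integrable
      fun y : EuclideanSpace ℝ (Fin d) => Real.exp (-(1 / 2 + t) * ‖y‖ ^ 2) := by
    by_contra h
    rw [integral_undef h] at hint
    exact hpos.ne hint
  calc
    _ = ∫⁻ y, ENNReal.ofReal (Real.exp (-(1 / 2 + t) * ‖y - p‖ ^ 2)) *
        ENNReal.ofReal (Real.exp (-(t / (1 + 2 * t)) * ‖a - b‖ ^ 2)) := by
      refine lintegral_congr fun y => ?_
      rw [← ENNReal.ofReal_mul (Real.exp_nonneg _), ← ENNReal.ofReal_mul (Real.exp_nonneg _),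
        ← Real.exp_add, ← Real.exp_add]
      congr 2
      linarith [hsq y]
    _ = _ := by
      rw [lintegral_mul_const _ (by fun_prop),
        lintegral_sub_right_eq_self
          (fun y => ENNReal.ofReal (Real.exp (-(1 / 2 + t) * ‖y‖ ^ 2))) p,
        ← ofReal_integral_eq_lintegral_ofReal hintegrable
          (Filter.Eventually.of_forall fun _ => Real.exp_nonneg _), hint]

theorem ofReal_gaussMixture {d k : ℕ} {w : ℝ} (hw : 0 ≤ w)
    (μ : Fin k → EuclideanSpace ℝ (Fin d)) (x : EuclideanSpace ℝ (Fin d)) :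
    ENNReal.ofReal (gaussMixture (fun _ => w) μ x) =
      ∑ i, ENNReal.ofReal (w * (2 * Real.pi) ^ (-(d : ℝ) / 2)) *
        ENNReal.ofReal (Real.exp (-‖x - μ i‖ ^ 2 / 2)) := by
  rw [gaussMixture, ENNReal.ofReal_sum_of_nonneg fun i _ => by positivity]
  refine Finset.sum_congr rfl fun i _ => ?_
  rw [← mul_assoc, ENNReal.ofReal_mul (by positivity)]

theorem measurable_gaussMixture {d k : ℕ} (w : Fin k → ℝ)
    (μ : Fin k → EuclideanSpace ℝ (Fin d)) : Measurable (gaussMixture w μ) := by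
  unfold gaussMixture
  fun_prop

/-- The Laplace transform of the distribution of distances of a uniform Gaussian mixture. -/
theorem exists_laplace_distDistrib_gaussMixture (d : ℕ) {w t : ℝ} (hw : 0 < w) (ht : 0 ≤ t) :
    ∃ K : ℝ, 0 < K ∧ ∀ (k : ℕ) (μ : Fin k → EuclideanSpace ℝ (Fin d)),
      ∫⁻ r, ENNReal.ofReal (Real.exp (-t * r)) ∂distDistrib (gaussMixture (fun _ => w) μ) =
        ENNReal.ofReal
          (K * ∑ i, ∑ j, Real.exp (-(t / (1 + 4 * t)) * ‖μ i - μ j‖ ^ 2)) := by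
  have hτ : 0 ≤ t / (1 + 2 * t) := by positivity
  set c : ℝ := w * (2 * Real.pi) ^ (-(d : ℝ) / 2)
  have hcpos : 0 < c := by positivity
  set A : ℝ := (Real.pi / (1 / 2 + t)) ^ (d / 2 : ℝ)
  have hApos : 0 < A := by positivity
  set B : ℝ := (Real.pi / (1 / 2 + t / (1 + 2 * t))) ^ (d / 2 : ℝ) with hB
  have hBpos : 0 < B := by positivity
  have hs : t / (1 + 2 * t) / (1 + 2 * (t / (1 + 2 * t))) = t / (1 + 4 * t) := by
    have : 1 + 2 * t ≠ 0 := by positivity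
    have : 1 + 4 * t ≠ 0 := by positivity
    have : 1 + 2 * t + 2 * t ≠ 0 := by positivity
    field_simp
    ring
  refine ⟨c * c * A * B, by positivity, fun k μ => ?_⟩
  have hm := (measurable_gaussMixture (fun _ => w) μ).ennreal_ofReal
  have hinner (x : EuclideanSpace ℝ (Fin d)) :
      ∫⁻ y, ENNReal.ofReal (Real.exp (-t * ‖x - y‖ ^ 2))
          ∂(volume.withDensity fun x => ENNReal.ofReal (gaussMixture (fun _ => w) μ x)) =
        ∑ j, ENNReal.ofReal c * (ENNReal.ofReal A *
          ENNReal.ofReal (Real.exp (-(t / (1 + 2 * t)) * ‖x - μ j‖ ^ 2))) := by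
    rw [lintegral_withDensity_eq_lintegral_mul _ hm (by fun_prop)]
    simp only [Pi.mul_apply, ofReal_gaussMixture hw.le, Finset.sum_mul, mul_assoc]
    rw [lintegral_finsetSum _ (by fun_prop)]
    refine Finset.sum_congr rfl fun j _ => ?_
    rw [lintegral_const_mul _ (by fun_prop), lintegral_gaussian_mul_gaussian x (μ j) ht]
  rw [distDistrib, lintegral_map (by fun_prop) (by fun_prop), lintegral_prod _ (by fun_prop)]
  simp only [hinner]
  rw [lintegral_withDensity_eq_lintegral_mul _ hm (by fun_prop)]
  simp only [Pi.mul_apply, ofReal_gaussMixture hw.le, Finset.sum_mul]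
  rw [lintegral_finsetSum _ (by fun_prop), Finset.mul_sum,
    ENNReal.ofReal_sum_of_nonneg fun i _ => by positivity]
  refine Finset.sum_congr rfl fun i _ => ?_
  simp only [Finset.mul_sum]
  rw [lintegral_finsetSum _ (by fun_prop),
    ENNReal.ofReal_sum_of_nonneg fun i _ => by positivity]
  refine Finset.sum_congr rfl fun j _ => ?_
  calc
    _ = ∫⁻ x, (ENNReal.ofReal c * ENNReal.ofReal c * ENNReal.ofReal A) *
        (ENNReal.ofReal (Real.exp (-‖x - μ i‖ ^ 2 / 2)) *
          ENNReal.ofReal (Real.exp (-(t / (1 + 2 * t)) * ‖μ j - x‖ ^ 2))) := by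
      refine lintegral_congr fun x => ?_
      rw [norm_sub_rev (μ j) x]
      ring
    _ = _ := by
      rw [lintegral_const_mul _ (by fun_prop), lintegral_gaussian_mul_gaussian (μ j) (μ i) hτ,
        hs, norm_sub_rev (μ j), ← hB, ENNReal.ofReal_mul (p := c * c * A * B) (by positivity),
        ENNReal.ofReal_mul (p := c * c * A) (by positivity),
        ENNReal.ofReal_mul (p := c * c) (by positivity), ENNReal.ofReal_mul hcpos.le]
      ring

theorem hasDerivAt_sum_pow_mul_exp {ι : Type*} [Fintype ι] (a : ι → ℝ) (n : ℕ) (s : ℝ) :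
    HasDerivAt (fun s => ∑ i, a i ^ n * Real.exp (-s * a i))
      (-∑ i, a i ^ (n + 1) * Real.exp (-s * a i)) s := by
  rw [← Finset.sum_neg_distrib]
  refine HasDerivAt.fun_sum fun i _ => ?_
  exact (((hasDerivAt_neg' s).mul_const (a i)).exp.const_mul (a i ^ n)).congr_deriv (by ring)

/-- Two finite exponential sums agreeing on an interval `(0, ε)` have equal power sums of
exponents. -/
theorem sum_pow_eq_of_sum_exp_eq {ι κ : Type*} [Fintype ι] [Fintype κ] {a : ι → ℝ} {b : κ → ℝ}
    {ε : ℝ} (hε : 0 < ε)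
    (h : ∀ s ∈ Set.Ioo 0 ε, ∑ i, Real.exp (-s * a i) = ∑ j, Real.exp (-s * b j)) (n : ℕ) :
    ∑ i, a i ^ n = ∑ j, b j ^ n := by
  have key : Set.EqOn (fun s => ∑ i, a i ^ n * Real.exp (-s * a i))
      (fun s => ∑ j, b j ^ n * Real.exp (-s * b j)) (Set.Ioo 0 ε) := by
    induction n with
    | zero => simpa [Set.EqOn] using h
    | succ n ih =>
      intro s hs
      have := (hasDerivAt_sum_pow_mul_exp a n s).unique
        ((hasDerivAt_sum_pow_mul_exp b n s).congr_of_eventuallyEq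
          (ih.eventuallyEq_of_mem (Ioo_mem_nhds hs.1 hs.2)))
      exact neg_injective this
  have hcl := key.closure (by fun_prop) (by fun_prop)
  rw [closure_Ioo hε.ne] at hcl
  simpa using hcl (Set.left_mem_Icc.2 hε.le)

theorem sum_prod_eq_two_mul_sum_lt {ι : Type*} [Fintype ι] [LinearOrder ι] {f : ι × ι → ℝ}
    (hf : ∀ p, f p.swap = f p) :
    ∑ p, f p = 2 * ∑ p with p.1 < p.2, f p + ∑ i, f (i, i) := by
  have hgt : ∑ p with p.2 < p.1, f p = ∑ p with p.1 < p.2, f p :=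
    Finset.sum_bij' (fun p _ => p.swap) (fun p _ => p.swap) (by simp) (by simp) (by simp)
      (by simp) fun p _ => (hf p).symm
  have hdiag : ∑ p with p.1 = p.2, f p = ∑ i, f (i, i) := by
    refine Finset.sum_bij' (fun p _ => p.1) (fun i _ => (i, i)) (by simp) (by simp) ?_ (by simp) ?_
    · rintro ⟨i, j⟩ h
      simp_all
    · rintro ⟨i, j⟩ h
      simp_all
  rw [← hdiag, two_mul]
  nth_rewrite 2 [← hgt]
  simp only [Finset.sum_filter, ← Finset.sum_add_distrib]
  refine Finset.sum_congr rfl fun p _ => ?_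
  rcases lt_trichotomy p.1 p.2 with h | h | h
  · simp [h, h.not_gt, h.ne]
  · simp [h]
  · simp [h, h.not_gt, ne_of_gt h]

/-- If two equally weighted identity-covariance Gaussian mixtures with `k` components have
the same distribution of distances, then for every `n ≥ 0` the power sums
`Σ_{i<j} ‖μᵢ - μⱼ‖^{2n}` of their squared pairwise distances agree. -/
theorem equal_distance_distribution_implies_equal_power_sums
    (d k : ℕ)
    (μ μbar : Fin k → EuclideanSpace ℝ (Fin d))
    (hlaw : distDistrib (gaussMixture (fun _ => (1 : ℝ) / k) μ)
          = distDistrib (gaussMixture (fun _ => (1 : ℝ) / k) μbar)) :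
    ∀ n : ℕ,
      ∑ p ∈ Finset.univ.filter (fun p : Fin k × Fin k => p.1 < p.2),
          ‖μ p.1 - μ p.2‖ ^ (2 * n)
        = ∑ p ∈ Finset.univ.filter (fun p : Fin k × Fin k => p.1 < p.2),
            ‖μbar p.1 - μbar p.2‖ ^ (2 * n) := by
  intro n
  rcases Nat.eq_zero_or_pos k with rfl | hk
  · simp
  rcases Nat.eq_zero_or_pos n with rfl | hn
  · simp
  have hw : (0 : ℝ) < 1 / k := by positivity
  have hexp : ∀ s ∈ Set.Ioo (0 : ℝ) (1 / 4),
      ∑ p : Fin k × Fin k, Real.exp (-s * ‖μ p.1 - μ p.2‖ ^ 2) =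
        ∑ p : Fin k × Fin k, Real.exp (-s * ‖μbar p.1 - μbar p.2‖ ^ 2) := by
    rintro s ⟨hs0, hs1⟩
    have hs : 0 < 1 - 4 * s := by linarith
    obtain ⟨K, hK, hlap⟩ :=
      exists_laplace_distDistrib_gaussMixture d hw (t := s / (1 - 4 * s)) (by positivity)
    have hts : s / (1 - 4 * s) / (1 + 4 * (s / (1 - 4 * s))) = s := by
      have : 1 + 4 * (s / (1 - 4 * s)) = 1 / (1 - 4 * s) := by
        field_simp
        ring
      rw [this, div_div_eq_mul_div, div_one, div_mul_cancel₀ _ hs.ne']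
    have h := hlap k μ
    rw [hlaw, hlap k μbar, hts, ENNReal.ofReal_eq_ofReal_iff (by positivity) (by positivity)] at h
    simpa only [Fintype.sum_prod_type] using (mul_left_cancel₀ hK.ne' h).symm
  have hsum := sum_pow_eq_of_sum_exp_eq (by norm_num) hexp n
  simp only [← pow_mul] at hsum
  rw [sum_prod_eq_two_mul_sum_lt (fun p => by simp [norm_sub_rev]),
    sum_prod_eq_two_mul_sum_lt (fun p => by simp [norm_sub_rev])] at hsum
  simpa [hn.ne'] using hsum
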